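/- arXiv:2204.00435 — 6 statements merged into one kernel-verified Lean document; each statement's English description precedes it below -/
import Mathlib

section
/- Soundness of nPC: for every i ∈ {1,…,n} and all finite multisets Γ, Δ of nPC formulas, if the sequent Γ ⊢_i Δ is provable in nPC then Γ ⊨_i Δ. -/
/-- Formulas of the n-dimensional propositional calculus nPC:
decorated variables `X^π`, constants `e_k`, and compounds `q(F,G_1,…,G_n)`.
Dimensions are elements of `Fin n`; propositional variables are natural numbers. -/
inductive Fm (n : ℕ) : Type where
  | var (X : ℕ) (π : Equiv.Perm (Fin n)) : Fm n
  | const (k : Fin n) : Fm n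
  | q (F : Fm n) (G : Fin n → Fm n) : Fm n

/-- The action `F^ρ` of a permutation `ρ` on a formula. -/
def Fm.act {n : ℕ} (ρ : Equiv.Perm (Fin n)) : Fm n → Fm n
  | .var X π => .var X (ρ * π)
  | .const k => .const (ρ k)
  | .q F G => .q F (fun j => (G j).act ρ)

/-- The action of a permutation on a multiset of formulas (context). -/
def actM {n : ℕ} (ρ : Equiv.Perm (Fin n)) (Γ : Multiset (Fm n)) : Multiset (Fm n) :=
  Γ.map (Fm.act ρ)

/-- The sequent calculus of nPC: `Proves Γ i Δ` means the sequent `Γ ⊢_i Δ` is provable. -/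
inductive Proves {n : ℕ} : Multiset (Fm n) → Fin n → Multiset (Fm n) → Prop where
  | const (i : Fin n) : Proves 0 i {Fm.const i}
  | id (X : ℕ) (π ρ : Equiv.Perm (Fin n)) (i : Fin n) (h : π⁻¹ i = ρ⁻¹ i) :
      Proves {Fm.var X π} i {Fm.var X ρ}
  | sym (Γ Δ : Multiset (Fm n)) (i j : Fin n)
      (h : Proves (actM (Equiv.swap i j) Γ) i (actM (Equiv.swap i j) Δ)) :
      Proves Γ j Δ
  | neg1 (Γ Δ : Multiset (Fm n)) (F : Fm n) (i j k : Fin n) (hik : i ≠ k)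
      (h : Proves (actM (Equiv.swap i j) Γ) i (F ::ₘ actM (Equiv.swap i j) Δ)) :
      Proves (F.act (Equiv.swap j k) ::ₘ Γ) j Δ
  | neg2 (Γ Δ : Multiset (Fm n)) (F : Fm n) (i j k : Fin n) (hjk : j ≠ k)
      (h : Proves (actM (Equiv.swap i j) Γ) i (F ::ₘ actM (Equiv.swap i j) Δ)) :
      Proves (F.act (Equiv.swap i k) ::ₘ Γ) j Δ
  | neg3 (Γ Δ : Multiset (Fm n)) (F : Fm n) (j : Fin n)
      (h : ∀ i : Fin n, i ≠ j →
        Proves (F ::ₘ actM (Equiv.swap i j) Γ) i (actM (Equiv.swap i j) Δ)) :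
      Proves Γ j (F ::ₘ Δ)
  | qL (Γ Δ : Multiset (Fm n)) (F : Fm n) (G : Fin n → Fm n) (i : Fin n)
      (h : ∀ j : Fin n,
        Proves ((G j).act (Equiv.swap j i) ::ₘ F ::ₘ actM (Equiv.swap j i) Γ) j
          (actM (Equiv.swap j i) Δ)) :
      Proves (Fm.q F G ::ₘ Γ) i Δ
  | qR (Γ Δ : Multiset (Fm n)) (F : Fm n) (G : Fin n → Fm n) (i : Fin n)
      (h : ∀ j : Fin n,
        Proves (F ::ₘ actM (Equiv.swap j i) Γ) j
          ((G j).act (Equiv.swap j i) ::ₘ actM (Equiv.swap j i) Δ)) :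
      Proves Γ i (Fm.q F G ::ₘ Δ)
  | cut (Γ Δ : Multiset (Fm n)) (F : Fm n) (i : Fin n)
      (h1 : Proves (F ::ₘ Γ) i Δ) (h2 : Proves Γ i (F ::ₘ Δ)) : Proves Γ i Δ
  | weakL (Γ Δ : Multiset (Fm n)) (F : Fm n) (i : Fin n)
      (h : Proves Γ i Δ) : Proves (F ::ₘ Γ) i Δ
  | weakR (Γ Δ : Multiset (Fm n)) (F : Fm n) (i : Fin n)
      (h : Proves Γ i Δ) : Proves Γ i (F ::ₘ Δ)
  | conL (Γ Δ : Multiset (Fm n)) (F : Fm n) (i : Fin n)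
      (h : Proves (F ::ₘ F ::ₘ Γ) i Δ) : Proves (F ::ₘ Γ) i Δ
  | conR (Γ Δ : Multiset (Fm n)) (F : Fm n) (i : Fin n)
      (h : Proves Γ i (F ::ₘ F ::ₘ Δ)) : Proves Γ i (F ::ₘ Δ)

/-- The semantics `⟦F⟧v` of a formula in an environment `v`. -/
def Fm.sem {n : ℕ} (v : ℕ → Fin n) : Fm n → Fin n
  | .var X π => π (v X)
  | .const k => k
  | .q F G => (G (F.sem v)).sem v

/-- `Γ ⊨_i Δ`: every environment making all of `Γ` equal `i` makes some formula of `Δ` equal `i`. -/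
def Models {n : ℕ} (Γ : Multiset (Fm n)) (i : Fin n) (Δ : Multiset (Fm n)) : Prop :=
  ∀ v : ℕ → Fin n, (∀ G ∈ Γ, Fm.sem v G = i) → ∃ F ∈ Δ, Fm.sem v F = i

/-- Logical equivalence `F ∼ G`: both `F ⊢_i G` and `G ⊢_i F` are provable for every `i`. -/
def Eqv {n : ℕ} (F G : Fm n) : Prop :=
  ∀ i : Fin n, Proves {F} i {G} ∧ Proves {G} i {F}

/-- Provability from a (possibly infinite) set of hypotheses:
some finite sub-multiset of `Γ` proves `Δ` at `i`. -/
def ProvesSet {n : ℕ} (Γ : Set (Fm n)) (i : Fin n) (Δ : Multiset (Fm n)) : Prop :=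
  ∃ Γ' : Multiset (Fm n), (∀ G ∈ Γ', G ∈ Γ) ∧ Proves Γ' i Δ

/-- `Γ ⊨_i F` for a set `Γ` of hypotheses. -/
def ModelsSet {n : ℕ} (Γ : Set (Fm n)) (i : Fin n) (F : Fm n) : Prop :=
  ∀ v : ℕ → Fin n, (∀ G ∈ Γ, Fm.sem v G = i) → Fm.sem v F = i

theorem Multiset.exists_mem_cons {α : Type*} {p : α → Prop} {a : α} {s : Multiset α} :
    (∃ x ∈ a ::ₘ s, p x) ↔ p a ∨ ∃ x ∈ s, p x := by
  simp

/-- The action of `ρ` on a formula composes its semantics with `ρ`. -/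
theorem Fm.sem_act {n : ℕ} (v : ℕ → Fin n) (ρ : Equiv.Perm (Fin n)) (F : Fm n) :
    (F.act ρ).sem v = ρ (F.sem v) := by
  induction F with
  | var X π => rfl
  | const k => rfl
  | q F G _ ihG => exact ihG _

theorem Fm.sem_act_swap_eq_left {n : ℕ} (v : ℕ → Fin n) (i j : Fin n) (F : Fm n) :
    (F.act (Equiv.swap i j)).sem v = i ↔ F.sem v = j := by
  rw [Fm.sem_act, Equiv.swap_apply_eq_iff, Equiv.swap_apply_left]

theorem forall_mem_actM_swap {n : ℕ} (v : ℕ → Fin n) (i j : Fin n) (Γ : Multiset (Fm n)) :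
    (∀ G ∈ actM (Equiv.swap i j) Γ, G.sem v = i) ↔ ∀ G ∈ Γ, G.sem v = j := by
  simp [actM, Fm.sem_act_swap_eq_left]

theorem exists_mem_actM_swap {n : ℕ} (v : ℕ → Fin n) (i j : Fin n) (Δ : Multiset (Fm n)) :
    (∃ F ∈ actM (Equiv.swap i j) Δ, F.sem v = i) ↔ ∃ F ∈ Δ, F.sem v = j := by
  simp [actM, Fm.sem_act_swap_eq_left]

/-- Soundness of nPC: if `Γ ⊢_i Δ` is provable then `Γ ⊨_i Δ`. -/
theorem nPC_soundness (n : ℕ) (hn : 2 ≤ n) (i : Fin n) (Γ Δ : Multiset (Fm n))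
    (h : Proves Γ i Δ) : Models Γ i Δ := by
  induction h with
  | const i => simp [Models, Fm.sem]
  | id X π ρ i h =>
    intro v hv
    have hπ : π (v X) = i := by simpa [Fm.sem] using hv
    refine ⟨_, Multiset.mem_singleton_self _, ?_⟩
    rw [Fm.sem, ← Equiv.Perm.eq_inv_iff_eq, ← h, Equiv.Perm.eq_inv_iff_eq, hπ]
  | sym Γ Δ i j _ ih =>
    intro v hv
    exact (exists_mem_actM_swap v i j Δ).1 (ih v ((forall_mem_actM_swap v i j Γ).2 hv))
  | neg1 Γ Δ F i j k hik _ ih =>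
    intro v hv
    rw [Multiset.forall_mem_cons, Fm.sem_act_swap_eq_left] at hv
    have hΔ := ih v ((forall_mem_actM_swap v i j Γ).2 hv.2)
    rw [Multiset.exists_mem_cons, exists_mem_actM_swap] at hΔ
    exact hΔ.resolve_left fun hF => hik (hF.symm.trans hv.1)
  | neg2 Γ Δ F i j k hjk _ ih =>
    intro v hv
    rw [Multiset.forall_mem_cons, Fm.sem_act] at hv
    have hΔ := ih v ((forall_mem_actM_swap v i j Γ).2 hv.2)
    rw [Multiset.exists_mem_cons, exists_mem_actM_swap] at hΔ
    refine hΔ.resolve_left fun hF => hjk ?_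
    rw [← hv.1, hF, Equiv.swap_apply_left]
  | neg3 Γ Δ F j _ ih =>
    intro v hv
    rw [Multiset.exists_mem_cons]
    refine or_iff_not_imp_left.2 fun hF => ?_
    rw [← exists_mem_actM_swap v (F.sem v) j]
    exact ih _ hF v (Multiset.forall_mem_cons.2 ⟨rfl, (forall_mem_actM_swap v _ j Γ).2 hv⟩)
  | qL Γ Δ F G i _ ih =>
    intro v hv
    rw [Multiset.forall_mem_cons] at hv
    rw [← exists_mem_actM_swap v (F.sem v) i]
    refine ih (F.sem v) v ?_
    rw [Multiset.forall_mem_cons, Multiset.forall_mem_cons, Fm.sem_act_swap_eq_left,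
      forall_mem_actM_swap]
    exact ⟨hv.1, rfl, hv.2⟩
  | qR Γ Δ F G i _ ih =>
    intro v hv
    have hΔ := ih (F.sem v) v
      (Multiset.forall_mem_cons.2 ⟨rfl, (forall_mem_actM_swap v _ i Γ).2 hv⟩)
    rw [Multiset.exists_mem_cons, Fm.sem_act_swap_eq_left, exists_mem_actM_swap] at hΔ
    exact Multiset.exists_mem_cons.2 hΔ
  | cut Γ Δ F i _ _ ih1 ih2 =>
    intro v hv
    rcases Multiset.exists_mem_cons.1 (ih2 v hv) with hF | hΔ
    · exact ih1 v (Multiset.forall_mem_cons.2 ⟨hF, hv⟩)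
    · exact hΔ
  | weakL Γ Δ F i _ ih =>
    intro v hv
    exact ih v (Multiset.forall_mem_cons.1 hv).2
  | weakR Γ Δ F i _ ih =>
    intro v hv
    exact Multiset.exists_mem_cons.2 (Or.inr (ih v hv))
  | conL Γ Δ F i _ ih =>
    intro v hv
    exact ih v (Multiset.forall_mem_cons.2 ⟨hv F (Multiset.mem_cons_self F Γ), hv⟩)
  | conR Γ Δ F i _ ih =>
    intro v hv
    simpa using ih v hv
end

section
/- The relation ∼ is a congruence for the operation q: if F_i ∼ G_i for all 0 ≤ i ≤ n, then q(F_0, F_1, …, F_n) ∼ q(G_0, G_1, …, G_n). -/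
theorem Fm.act_one {n : ℕ} (F : Fm n) : F.act 1 = F := by
  induction F with
  | var X π => simp [Fm.act]
  | const k => simp [Fm.act]
  | q F G _ ihG => simp [Fm.act, ihG]

theorem Fm.act_act {n : ℕ} (σ ρ : Equiv.Perm (Fin n)) (F : Fm n) :
    (F.act ρ).act σ = F.act (σ * ρ) := by
  induction F with
  | var X π => simp [Fm.act, mul_assoc]
  | const k => simp [Fm.act]
  | q F G _ ihG => simp [Fm.act, ihG]

theorem Fm.act_swap_act_swap {n : ℕ} (i j : Fin n) (F : Fm n) :
    (F.act (Equiv.swap i j)).act (Equiv.swap j i) = F := by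
  rw [Fm.act_act, Equiv.swap_comm j i, Equiv.swap_mul_self, Fm.act_one]

theorem actM_one {n : ℕ} (Γ : Multiset (Fm n)) : actM 1 Γ = Γ := by
  simp [actM, Fm.act_one]

/-- A provable sequent between two formulas can be transported to any other dimension. -/
theorem Proves.act_swap {n : ℕ} {F G : Fm n} {i : Fin n} (h : Proves {F} i {G}) (j : Fin n) :
    Proves {F.act (Equiv.swap j i)} j {G.act (Equiv.swap j i)} := by
  refine Proves.sym _ _ i j ?_
  simpa [actM, Fm.act_swap_act_swap] using h

/-- `G` and `F^{(kj)}` are contradictory in dimension `k` when `G ⊢_k F` and `k ≠ j`. -/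
theorem Proves.act_swap_left {n : ℕ} {F G : Fm n} {j k : Fin n} (hkj : k ≠ j)
    (h : Proves {G} k {F}) : Proves (F.act (Equiv.swap k j) ::ₘ {G}) k 0 := by
  refine Proves.neg1 _ _ F k k j hkj ?_
  rwa [Equiv.swap_self, ← Equiv.Perm.one_def, actM_one, actM_one]

/-- The compound `q` is monotone for provability in its branches, and antitone in its head. -/
theorem Proves.q_mono {n : ℕ} {F0 G0 : Fm n} {F G : Fin n → Fm n}
    (h0 : ∀ k, Proves {G0} k {F0}) {i : Fin n} (h : ∀ j, Proves {F j} i {G j}) :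
    Proves {Fm.q F0 F} i {Fm.q G0 G} := by
  refine Proves.qL 0 _ F0 F i fun j => ?_
  refine Proves.qR _ 0 G0 (fun k => (G k).act (Equiv.swap j i)) j fun k => ?_
  by_cases hkj : k = j
  · subst hkj
    rw [Equiv.swap_self, ← Equiv.Perm.one_def, actM_one, actM_one, Fm.act_one,
      Multiset.cons_swap _ F0]
    exact Proves.weakL _ _ _ _ (Proves.weakL _ _ _ _ ((h k).act_swap k))
  · have hcontra := Proves.weakR _ _ (((G k).act (Equiv.swap j i)).act (Equiv.swap k j)) _
      (Proves.act_swap_left hkj (h0 k))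
    have hweak := Proves.weakL _ _ (((F j).act (Equiv.swap j i)).act (Equiv.swap k j)) _ hcontra
    convert hweak using 1
    · simp only [actM, Multiset.map_zero, ← Multiset.singleton_add]
      abel
    · simp [actM]

/-- `∼` is a congruence for `q`: if `F_i ∼ G_i` for `0 ≤ i ≤ n`, then
`q(F_0,F_1,…,F_n) ∼ q(G_0,G_1,…,G_n)`. -/
theorem eqv_congruence_q (n : ℕ) (hn : 2 ≤ n) (F0 G0 : Fm n) (F G : Fin n → Fm n)
    (h0 : Eqv F0 G0) (h : ∀ i : Fin n, Eqv (F i) (G i)) :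
    Eqv (Fm.q F0 F) (Fm.q G0 G) := by
  exact fun i => ⟨Proves.q_mono (fun k => (h0 k).2) fun j => (h j i).1,
    Proves.q_mono (fun k => (h0 k).1) fun j => (h j i).2⟩
end

section
/- The Lindenbaum algebra L_n = F_n/∼ is a Boolean algebra of dimension n; that is, writing [F] for the ∼-class of F, the following identities hold in L_n for all elements: q([e_k], x_1, …, x_n) = x_k for every k; (B1) q(c, [e_1], …, [e_n]) = c; (B2) q(c, x, x, …, x) = x; and (B3, compatibility of q with itself) q(c, q(y^1_0, y^1_1, …, y^1_n), …, q(y^n_0, y^n_1, …, y^n_n)) = q(q(c, y^1_0, …, y^n_0), q(c, y^1_1, …, y^n_1), …, q(c, y^1_n, …, y^n_n)). -/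
namespace Fm

variable {n : ℕ}

lemma act_act_s11 (ρ σ : Equiv.Perm (Fin n)) (F : Fm n) : (F.act σ).act ρ = F.act (ρ * σ) := by
  induction F with
  | var X π => simp [act, mul_assoc]
  | const k => simp [act]
  | q F G _ ihG => simp only [act, ihG]

lemma act_one_s11 (F : Fm n) : F.act 1 = F := by
  induction F with
  | var X π => simp [act]
  | const k => simp [act]
  | q F G _ ihG => simp only [act, ihG]

/-- `F.atVal i k` is `F^{(ik)}`: at the turnstile `⊢_i` it expresses that `F` has value `k`. -/
abbrev atVal (i k : Fin n) (F : Fm n) : Fm n := F.act (Equiv.swap i k)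

lemma atVal_self (i : Fin n) (F : Fm n) : F.atVal i i = F := by
  rw [atVal, Equiv.swap_self]
  exact act_one_s11 F

lemma atVal_atVal_comm (i k : Fin n) (F : Fm n) : (F.atVal k i).atVal i k = F := by
  rw [atVal, atVal, act_act_s11, Equiv.swap_comm, Equiv.swap_mul_self, act_one_s11]

end Fm

namespace Proves

variable {n : ℕ} {Γ Δ : Multiset (Fm n)} {i : Fin n}

lemma actM_actM_swap (i k : Fin n) (Γ : Multiset (Fm n)) :
    actM (Equiv.swap i k) (actM (Equiv.swap k i) Γ) = Γ := by
  simp only [actM, Multiset.map_map, Function.comp_def]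
  simpa using Multiset.map_congr rfl fun F _ => Fm.atVal_atVal_comm i k F

lemma weakening {Γ' Δ' : Multiset (Fm n)} (h : Proves Γ i Δ) (hΓ : Γ ≤ Γ') (hΔ : Δ ≤ Δ') :
    Proves Γ' i Δ' := by
  obtain ⟨Γ₁, rfl⟩ := Multiset.le_iff_exists_add.1 hΓ
  obtain ⟨Δ₁, rfl⟩ := Multiset.le_iff_exists_add.1 hΔ
  have hL : Proves (Γ + Γ₁) i Δ := by
    clear hΓ
    induction Γ₁ using Multiset.induction_on with
    | empty => simpa using h
    | cons F Γ₁ ih => simpa only [Multiset.add_cons] using weakL _ _ F i ih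
  clear hΔ
  induction Δ₁ using Multiset.induction_on with
  | empty => simpa using hL
  | cons F Δ₁ ih => simpa only [Multiset.add_cons] using weakR _ _ F i ih

/-- The rule (qL) with all premises transported to the turnstile of the conclusion. -/
lemma q_left {F : Fm n} {G : Fin n → Fm n}
    (h : ∀ k, Proves (G k ::ₘ F.atVal i k ::ₘ Γ) i Δ) : Proves (Fm.q F G ::ₘ Γ) i Δ := by
  refine qL _ _ _ _ _ fun k => sym _ _ i k ?_
  have hΓ : actM (Equiv.swap i k) ((G k).act (Equiv.swap k i) ::ₘ F ::ₘ actM (Equiv.swap k i) Γ)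
      = G k ::ₘ F.atVal i k ::ₘ Γ := by
    conv_rhs => rw [← Fm.atVal_atVal_comm i k (G k), ← actM_actM_swap i k Γ]
    simp [actM]
  rw [hΓ, actM_actM_swap]
  exact h k

/-- The rule (qR) with all premises transported to the turnstile of the conclusion. -/
lemma q_right {F : Fm n} {G : Fin n → Fm n}
    (h : ∀ k, Proves (F.atVal i k ::ₘ Γ) i (G k ::ₘ Δ)) : Proves Γ i (Fm.q F G ::ₘ Δ) := by
  refine qR _ _ _ _ _ fun k => sym _ _ i k ?_
  have hΓ : actM (Equiv.swap i k) (F ::ₘ actM (Equiv.swap k i) Γ) = F.atVal i k ::ₘ Γ := by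
    conv_rhs => rw [← actM_actM_swap i k Γ]
    simp [actM]
  have hΔ : actM (Equiv.swap i k) ((G k).act (Equiv.swap k i) ::ₘ actM (Equiv.swap k i) Δ)
      = G k ::ₘ Δ := by
    conv_rhs => rw [← Fm.atVal_atVal_comm i k (G k), ← actM_actM_swap i k Δ]
    simp [actM]
  rw [hΓ, hΔ]
  exact h k

/-- A formula satisfying the identity sequents cannot have two distinct values. -/
lemma contradiction_of_identity {F : Fm n} (hF : ∀ i, Proves {F} i {F}) {j k : Fin n}
    (hjk : j ≠ k) : Proves (F.atVal i j ::ₘ {F.atVal i k}) i 0 := by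
  refine neg1 {F.atVal i k} 0 F k i j hjk.symm ?_
  have h := hF k
  rw [← Fm.atVal_atVal_comm k i F] at h
  simpa [actM, Fm.atVal_atVal_comm] using h

lemma const_contradiction {k l : Fin n} (hkl : k ≠ l) (h : (Fm.const k).atVal i l ∈ Γ) :
    Proves Γ i Δ := by
  have h₀ : Proves {(Fm.const k).atVal i l} i 0 := neg1 0 0 (Fm.const k) k i l hkl (const k)
  exact h₀.weakening (Multiset.singleton_le.2 h) (Multiset.zero_le _)

lemma singleton_identity (F : Fm n) : ∀ i, Proves {F} i {F} := by
  induction F with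
  | var X π => exact fun i => id X π π i rfl
  | const k =>
    intro i
    by_cases hki : k = i
    · subst hki
      exact (const k).weakening (Multiset.zero_le _) le_rfl
    · exact const_contradiction hki (by simp [Fm.atVal_self])
  | q F G ihF ihG =>
    intro i
    refine q_right (Δ := 0) fun k => ?_
    rw [← Multiset.cons_zero (Fm.q F G), Multiset.cons_swap]
    refine q_left fun l => ?_
    by_cases hlk : l = k
    · subst hlk
      exact (ihG l i).weakening (by simp) le_rfl
    · exact (contradiction_of_identity ihF hlk).weakening (Multiset.le_cons_self _ _)
        (Multiset.zero_le _)

lemma identity {F : Fm n} (hΓ : F ∈ Γ) (hΔ : F ∈ Δ) : Proves Γ i Δ :=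
  (singleton_identity F i).weakening (Multiset.singleton_le.2 hΓ) (Multiset.singleton_le.2 hΔ)

lemma contradiction (F : Fm n) {j k : Fin n} (hjk : j ≠ k) (hj : F.atVal i j ∈ Γ)
    (hk : F.atVal i k ∈ Γ) : Proves Γ i Δ := by
  have h := contradiction_of_identity (i := i) (singleton_identity F) hjk
  by_cases heq : F.atVal i j = F.atVal i k
  · rw [heq] at h
    exact (conL 0 0 _ i h).weakening (Multiset.singleton_le.2 hk) (Multiset.zero_le _)
  · refine h.weakening ?_ (Multiset.zero_le _)
    refine (Multiset.le_iff_subset ?_).2 ?_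
    · simpa using heq
    · simp [Multiset.cons_subset, hj, hk]

end Proves

section Identities

variable {n : ℕ}

open Proves

lemma eqv_q_const (k : Fin n) (x : Fin n → Fm n) : Eqv (Fm.q (Fm.const k) x) (x k) := by
  refine fun i => ⟨q_left (Γ := 0) fun j => ?_, q_right (Δ := 0) fun j => ?_⟩
  all_goals
    by_cases hkj : k = j
    · subst hkj
      exact identity (F := x k) (by simp) (by simp)
    · exact const_contradiction hkj (by simp)

lemma eqv_q_consts (c : Fm n) : Eqv (Fm.q c fun j => Fm.const j) c := by
  refine fun i => ⟨q_left (Γ := 0) fun j => ?_, q_right (Δ := 0) fun j => ?_⟩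
  · by_cases hji : j = i
    · subst hji
      exact identity (F := c) (by simp [Fm.atVal_self]) (by simp)
    · exact const_contradiction hji (by simp [Fm.atVal_self])
  · by_cases hji : j = i
    · subst hji
      exact (Proves.const j).weakening (Multiset.zero_le _) (by simp)
    · exact contradiction c hji (by simp) (by simp [Fm.atVal_self])

lemma eqv_q_diagonal (c x : Fm n) : Eqv (Fm.q c fun _ => x) x :=
  fun _ => ⟨q_left (Γ := 0) fun _ => identity (F := x) (by simp) (by simp),
    q_right (Δ := 0) fun _ => identity (F := x) (by simp) (by simp)⟩

lemma eqv_q_q (c : Fm n) (y0 : Fin n → Fm n) (y : Fin n → Fin n → Fm n) :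
    Eqv (Fm.q c fun r => Fm.q (y0 r) (y r))
      (Fm.q (Fm.q c y0) fun k => Fm.q c fun r => y r k) := by
  refine fun i => ⟨?_, ?_⟩
  · refine q_left (Γ := 0) fun r => q_left fun k => q_right (Δ := 0) fun m =>
      q_left fun s => q_right fun t => ?_
    by_cases hsr : s = r
    swap; · exact contradiction c hsr (by simp) (by simp)
    by_cases htr : t = r
    swap; · exact contradiction c htr (by simp) (by simp)
    subst hsr htr
    by_cases hmk : m = k
    swap; · exact contradiction (y0 t) hmk (by simp) (by simp)
    subst hmk
    exact identity (F := y t m) (by simp) (by simp)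
  · refine q_left (Γ := 0) fun m => q_left fun s => ?_
    rw [Multiset.cons_swap (c.atVal i s), Multiset.cons_swap (y s m)]
    refine q_left fun t => q_right (Δ := 0) fun r => q_right fun k => ?_
    by_cases hsr : s = r
    swap; · exact contradiction c hsr (by simp) (by simp)
    by_cases htr : t = r
    swap; · exact contradiction c htr (by simp) (by simp)
    subst hsr htr
    by_cases hmk : m = k
    swap; · exact contradiction (y0 t) hmk (by simp) (by simp)
    subst hmk
    exact identity (F := y t m) (by simp) (by simp)

end Identities

/-- The Lindenbaum algebra `L_n = F_n/∼` is a Boolean algebra of dimension `n`: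
the defining identities hold in `L_n`, i.e. the corresponding `∼`-equivalences hold
for all representatives:
`q(e_k, x_1, …, x_n) = x_k`; (B1) `q(c, e_1, …, e_n) = c`; (B2) `q(c, x, …, x) = x`;
(B3) `q(c, q(y¹₀,y¹₁,…,y¹ₙ), …, q(yⁿ₀,…,yⁿₙ)) =
      q(q(c,y¹₀,…,yⁿ₀), q(c,y¹₁,…,yⁿ₁), …, q(c,y¹ₙ,…,yⁿₙ))`. -/
theorem lindenbaum_is_nBA (n : ℕ) (hn : 2 ≤ n) :
    (∀ (k : Fin n) (x : Fin n → Fm n), Eqv (Fm.q (Fm.const k) x) (x k)) ∧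
    (∀ c : Fm n, Eqv (Fm.q c (fun j => Fm.const j)) c) ∧
    (∀ c x : Fm n, Eqv (Fm.q c (fun _ => x)) x) ∧
    (∀ (c : Fm n) (y0 : Fin n → Fm n) (y : Fin n → Fin n → Fm n),
      Eqv (Fm.q c (fun r => Fm.q (y0 r) (y r)))
          (Fm.q (Fm.q c y0) (fun k => Fm.q c (fun r => y r k)))) := by
  exact ⟨eqv_q_const, eqv_q_consts, eqv_q_diagonal, eqv_q_q⟩
end

section
/- Let U = (U_1,…,U_n) be an ultramultideal of the Lindenbaum algebra L_n, and let v^U be the environment defined by v^U(X) = the unique i ∈ {1,…,n} such that [X^{id}] ∈ U_i. Then for every nPC formula F and every i ∈ {1,…,n}: ⟦F⟧v^U = i if and only if [F] ∈ U_i. -/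
/-- If `σ` does not fix `j`, then `X^σ` and `X^{id}` are jointly refuted at `j`. -/
theorem Proves.var_absurd {n : ℕ} (X : ℕ) (σ : Equiv.Perm (Fin n)) (j : Fin n)
    (h : σ j ≠ j) : Proves {Fm.var X σ, Fm.var X 1} j 0 := by
  have key := Proves.neg1 {Fm.var X 1} 0 (Fm.var X (Equiv.swap j (σ j) * σ)) j j (σ j) h.symm
    (by
      simp only [actM, Multiset.map_singleton, Multiset.map_zero, Fm.act]
      refine Proves.id X _ _ j ?_
      simp [Equiv.swap_self])
  simpa [Fm.act, ← mul_assoc] using key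

/-- A constant other than `e_j` is refuted at `j`. -/
theorem Proves.const_absurd {n : ℕ} (j m : Fin n) (h : m ≠ j) :
    Proves {Fm.const m} j 0 := by
  have key := Proves.neg1 0 0 (Fm.const j) j j m h.symm (Proves.const j)
  simpa [Fm.act] using key

/-- A decorated variable `X^π` is equivalent to `q(X^{id}, e_{π(1)}, …, e_{π(n)})`. -/
theorem Eqv.var_q {n : ℕ} (X : ℕ) (π : Equiv.Perm (Fin n)) :
    Eqv (Fm.var X π) (Fm.q (Fm.var X 1) fun j => Fm.const (π j)) := by
  refine fun i => ⟨Proves.qR {Fm.var X π} 0 _ _ i fun j => ?_,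
    Proves.qL 0 {Fm.var X π} _ _ i fun j => ?_⟩
  · simp only [actM, Multiset.map_singleton, Multiset.map_zero, Fm.act]
    by_cases h : π j = i
    · rw [h, Equiv.swap_apply_right]
      exact Proves.weakL _ _ _ _ (Proves.weakL 0 _ _ _ (Proves.const j))
    · refine Proves.weakR _ _ _ _ ?_
      have := Proves.var_absurd X (Equiv.swap j i * π) j (by
        simpa [Equiv.swap_apply_eq_iff] using h)
      rwa [Multiset.pair_comm] at this
  · simp only [actM, Multiset.map_singleton, Multiset.map_zero, Fm.act]
    by_cases h : π j = i
    · refine Proves.weakL _ _ _ _ (Proves.id X _ _ j ?_)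
      rw [eq_comm, Equiv.Perm.inv_eq_iff_eq]
      simp [h]
    · rw [Multiset.cons_swap]
      exact Proves.weakR _ _ _ _ (Proves.weakL _ _ _ _ (Proves.const_absurd j _ (by
        simpa [Equiv.swap_apply_eq_iff] using h)))

/-- Let `U = (U_1,…,U_n)` be an ultramultideal of the Lindenbaum algebra
`L_n = F_n/∼` (pairwise disjoint subsets covering `L_n`, satisfying (m1)–(m3)),
and let `v^U` be the environment with `[X^{id}] ∈ U_{v^U(X)}`.
Then for every formula `F` and every `i`: `⟦F⟧v^U = i` iff `[F] ∈ U_i`. -/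
theorem ultramultideal_environment (n : ℕ) (hn : 2 ≤ n)
    (U : Fin n → Set (Quot (@Eqv n)))
    (hdisj : ∀ i j : Fin n, i ≠ j → Disjoint (U i) (U j))
    (hcover : ∀ x : Quot (@Eqv n), ∃ i : Fin n, x ∈ U i)
    (hm1 : ∀ k : Fin n, Quot.mk (@Eqv n) (Fm.const k) ∈ U k)
    (hm2 : ∀ (r k : Fin n) (F G : Fm n) (H : Fin n → Fm n),
      Quot.mk (@Eqv n) F ∈ U r → Quot.mk (@Eqv n) G ∈ U k →
      Quot.mk (@Eqv n) (Fm.q F (Function.update H r G)) ∈ U k)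
    (hm3 : ∀ (k : Fin n) (F : Fm n) (Hs : Fin n → Fm n),
      (∀ l : Fin n, Quot.mk (@Eqv n) (Hs l) ∈ U k) →
      Quot.mk (@Eqv n) (Fm.q F Hs) ∈ U k)
    (v : ℕ → Fin n)
    (hv : ∀ X : ℕ, Quot.mk (@Eqv n) (Fm.var X 1) ∈ U (v X)) :
    ∀ (F : Fm n) (i : Fin n), Fm.sem v F = i ↔ Quot.mk (@Eqv n) F ∈ U i := by
  have hmem : ∀ F : Fm n, Quot.mk (@Eqv n) F ∈ U (Fm.sem v F) := by
    intro F
    induction F with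
    | var X π =>
      rw [Quot.sound (Eqv.var_q X π)]
      simpa [Fm.sem] using
        hm2 (v X) (π (v X)) _ _ (fun j => Fm.const (π j)) (hv X) (hm1 _)
    | const k => exact hm1 k
    | q F G ihF ihG =>
      simpa [Fm.sem] using hm2 _ _ F _ G ihF (ihG (Fm.sem v F))
  refine fun F i => ⟨fun h => h ▸ hmem F, fun h => ?_⟩
  by_contra hne
  exact Set.disjoint_left.mp (hdisj _ _ hne) (hmem F) h
end

section
/- For every 2PC formula F, every classical propositional formula P, and every environment v : V → {1,2}: ⟦F⟧v = 1 (in 2PC semantics) if and only if ⟦F•⟧v = 1 (in PC semantics), and ⟦P⟧v = 1 (in PC semantics) if and only if ⟦P°⟧v = 1 (in 2PC semantics). -/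
/-- Formulas of classical propositional calculus PC. -/
inductive PFm : Type where
  | tru : PFm
  | fls : PFm
  | var (X : ℕ) : PFm
  | neg (P : PFm) : PFm
  | and (P Q : PFm) : PFm
  | or (P Q : PFm) : PFm

/-- PC semantics with values in `Fin 2`: `0` plays the role of true (`1` in the paper)
and `1` plays the role of false (`0` in the paper). -/
def PFm.sem (v : ℕ → Fin 2) : PFm → Fin 2
  | .tru => 0
  | .fls => 1
  | .var X => v X
  | .neg P => if P.sem v = 0 then 1 else 0
  | .and P Q => if P.sem v = 0 ∧ Q.sem v = 0 then 0 else 1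
  | .or P Q => if P.sem v = 0 ∨ Q.sem v = 0 then 0 else 1

/-- The translation `(·)•` from 2PC formulas to PC formulas. -/
def toPC : Fm 2 → PFm
  | .var X π => if π 0 = 0 then .var X else .neg (.var X)
  | .const k => if k = 0 then .tru else .fls
  | .q F G => .or (.and (toPC F) (toPC (G 0))) (.and (.neg (toPC F)) (toPC (G 1)))

/-- The translation `(·)°` from PC formulas to 2PC formulas. -/
def toFm : PFm → Fm 2
  | .tru => .const 0
  | .fls => .const 1
  | .var X => .var X 1
  | .neg P => (toFm P).act (Equiv.swap 0 1)
  | .and P Q => .q (toFm P) ![toFm Q, .const 1]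
  | .or P Q => .q (toFm P) ![.const 0, toFm Q]

/-- The classical sequent calculus for PC. -/
inductive PProves : Multiset PFm → Multiset PFm → Prop where
  | tru : PProves 0 {PFm.tru}
  | fls : PProves {PFm.fls} 0
  | id (P : PFm) : PProves {P} {P}
  | andL (Γ Δ : Multiset PFm) (P Q : PFm)
      (h : PProves (P ::ₘ Q ::ₘ Γ) Δ) : PProves (PFm.and P Q ::ₘ Γ) Δ
  | andR (Γ Δ : Multiset PFm) (P Q : PFm)
      (h1 : PProves Γ (P ::ₘ Δ)) (h2 : PProves Γ (Q ::ₘ Δ)) :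
      PProves Γ (PFm.and P Q ::ₘ Δ)
  | orL (Γ Δ : Multiset PFm) (P Q : PFm)
      (h1 : PProves (P ::ₘ Γ) Δ) (h2 : PProves (Q ::ₘ Γ) Δ) :
      PProves (PFm.or P Q ::ₘ Γ) Δ
  | orR (Γ Δ : Multiset PFm) (P Q : PFm)
      (h : PProves Γ (P ::ₘ Q ::ₘ Δ)) : PProves Γ (PFm.or P Q ::ₘ Δ)
  | negL (Γ Δ : Multiset PFm) (P : PFm)
      (h : PProves Γ (P ::ₘ Δ)) : PProves (PFm.neg P ::ₘ Γ) Δ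
  | negR (Γ Δ : Multiset PFm) (P : PFm)
      (h : PProves (P ::ₘ Γ) Δ) : PProves Γ (PFm.neg P ::ₘ Δ)
  | cut (Γ Δ : Multiset PFm) (P : PFm)
      (h1 : PProves (P ::ₘ Γ) Δ) (h2 : PProves Γ (P ::ₘ Δ)) : PProves Γ Δ
  | weakL (Γ Δ : Multiset PFm) (P : PFm) (h : PProves Γ Δ) : PProves (P ::ₘ Γ) Δ
  | weakR (Γ Δ : Multiset PFm) (P : PFm) (h : PProves Γ Δ) : PProves Γ (P ::ₘ Δ)
  | conL (Γ Δ : Multiset PFm) (P : PFm)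
      (h : PProves (P ::ₘ P ::ₘ Γ) Δ) : PProves (P ::ₘ Γ) Δ
  | conR (Γ Δ : Multiset PFm) (P : PFm)
      (h : PProves Γ (P ::ₘ P ::ₘ Δ)) : PProves Γ (P ::ₘ Δ)

/-- `Γ ⊨ Δ` for PC. -/
def PModels (Γ Δ : Multiset PFm) : Prop :=
  ∀ v : ℕ → Fin 2, (∀ P ∈ Γ, PFm.sem v P = 0) → ∃ Q ∈ Δ, PFm.sem v Q = 0

theorem sem_toPC (v : ℕ → Fin 2) (F : Fm 2) : (toPC F).sem v = F.sem v := by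
  induction F with
  | var X π =>
    have key : ∀ (π : Equiv.Perm (Fin 2)) (x : Fin 2),
        (if π 0 = 0 then x else if x = 0 then 1 else 0) = π x := by decide
    rw [Fm.sem, ← key, toPC]
    split_ifs <;> simp_all [PFm.sem]
  | const k => fin_cases k <;> rfl
  | q F G ihF ihG =>
    simp only [toPC, PFm.sem, Fm.sem, ihF, ihG]
    generalize F.sem v = a
    fin_cases a
    · generalize h : (G 0).sem v = b
      fin_cases b <;> simp [h]
    · generalize h : (G 1).sem v = b
      fin_cases b <;> simp [h]

theorem sem_toFm (v : ℕ → Fin 2) (P : PFm) : (toFm P).sem v = P.sem v := by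
  induction P with
  | tru => rfl
  | fls => rfl
  | var X => rfl
  | neg P ih =>
    rw [toFm, Fm.sem_act, ih, PFm.sem]
    generalize P.sem v = a
    decide +revert
  | and P Q ihP ihQ =>
    simp only [toFm, PFm.sem, Fm.sem, ihP, ← ihQ]
    generalize P.sem v = a
    fin_cases a
    · generalize h : (toFm Q).sem v = b
      fin_cases b <;> simp [h]
    · simp [Fm.sem]
  | or P Q ihP ihQ =>
    simp only [toFm, PFm.sem, Fm.sem, ihP, ← ihQ]
    generalize P.sem v = a
    fin_cases a
    · simp [Fm.sem]
    · generalize h : (toFm Q).sem v = b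
      fin_cases b <;> simp [h]

/-- For every 2PC formula `F`, PC formula `P`, and environment `v`:
`⟦F⟧v = 1` iff `⟦F•⟧v = 1`, and `⟦P⟧v = 1` iff `⟦P°⟧v = 1`
(the truth value `1` of the paper is encoded as `0 : Fin 2`). -/
theorem translations_preserve_truth :
    (∀ (F : Fm 2) (v : ℕ → Fin 2), Fm.sem v F = 0 ↔ PFm.sem v (toPC F) = 0) ∧
    (∀ (P : PFm) (v : ℕ → Fin 2), PFm.sem v P = 0 ↔ Fm.sem v (toFm P) = 0) := by
  exact ⟨fun F v => by rw [sem_toPC], fun P v => by rw [sem_toFm]⟩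
end

section
/- Let Γ, Δ be finite multisets of 2PC formulas. If Γ ⊢_2 Δ is provable in the 2PC sequent calculus, then (Γ^{(12)})• ⊢ (Δ^{(12)})• is provable in the classical PC sequent calculus. -/
theorem forall_mem_actM_sem_eq {n : ℕ} (v : ℕ → Fin n) (ρ : Equiv.Perm (Fin n))
    (Γ : Multiset (Fm n)) (i : Fin n) :
    (∀ G ∈ actM ρ Γ, G.sem v = i) ↔ ∀ G ∈ Γ, G.sem v = ρ⁻¹ i := by
  simp only [actM, Multiset.mem_map, forall_exists_index, and_imp, forall_apply_eq_imp_iff₂,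
    Fm.sem_act, Equiv.Perm.eq_inv_iff_eq]

theorem exists_mem_actM_sem_eq {n : ℕ} (v : ℕ → Fin n) (ρ : Equiv.Perm (Fin n))
    (Γ : Multiset (Fm n)) (i : Fin n) :
    (∃ G ∈ actM ρ Γ, G.sem v = i) ↔ ∃ G ∈ Γ, G.sem v = ρ⁻¹ i := by
  simp only [actM, Multiset.mem_map, exists_exists_and_eq_and, Fm.sem_act,
    Equiv.Perm.eq_inv_iff_eq]

/-- Every sequent provable in nPC is valid. -/
theorem Proves.models {n : ℕ} {Γ Δ : Multiset (Fm n)} {i : Fin n} (h : Proves Γ i Δ) :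
    Models Γ i Δ := by
  induction h with
  | const i => intro v _; simp [Fm.sem]
  | id X π ρ i h =>
    intro v hv
    have hX : v X = ρ⁻¹ i := by
      rw [← h, Equiv.Perm.eq_inv_iff_eq]
      simpa [Fm.sem] using hv
    simp [Fm.sem, hX]
  | sym Γ Δ i j _ ih =>
    intro v hv
    have := ih v
    simp only [forall_mem_actM_sem_eq, exists_mem_actM_sem_eq, Equiv.swap_inv,
      Equiv.swap_apply_left] at this
    exact this hv
  | neg1 Γ Δ F i j k hik _ ih =>
    intro v hv
    have := ih v
    simp only [forall_mem_actM_sem_eq, exists_mem_actM_sem_eq, Equiv.swap_inv,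
      Equiv.swap_apply_left, Multiset.exists_mem_cons, Multiset.forall_mem_cons,
      Fm.sem_act] at this hv
    refine (this hv.2).resolve_left fun hF => hik ?_
    rw [← hF, Equiv.swap_apply_eq_iff.1 hv.1, Equiv.swap_apply_left]
  | neg2 Γ Δ F i j k hjk _ ih =>
    intro v hv
    have := ih v
    simp only [forall_mem_actM_sem_eq, exists_mem_actM_sem_eq, Equiv.swap_inv,
      Equiv.swap_apply_left, Multiset.exists_mem_cons, Multiset.forall_mem_cons,
      Fm.sem_act] at this hv
    refine (this hv.2).resolve_left fun hF => hjk ?_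
    rw [← hv.1, hF, Equiv.swap_apply_left]
  | neg3 Γ Δ F j _ ih =>
    intro v hv
    rw [Multiset.exists_mem_cons]
    by_cases hF : F.sem v = j
    · exact Or.inl hF
    · have := ih _ hF v
      simp only [forall_mem_actM_sem_eq, exists_mem_actM_sem_eq, Equiv.swap_inv,
        Equiv.swap_apply_left, Multiset.forall_mem_cons, true_and] at this
      exact Or.inr (this hv)
  | qL Γ Δ F G i _ ih =>
    intro v hv
    have := ih (F.sem v) v
    simp only [forall_mem_actM_sem_eq, exists_mem_actM_sem_eq, Equiv.swap_inv,
      Equiv.swap_apply_left, Multiset.forall_mem_cons, Fm.sem_act, Fm.sem, true_and] at this hv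
    exact this ⟨by rw [hv.1, Equiv.swap_apply_right], hv.2⟩
  | qR Γ Δ F G i _ ih =>
    intro v hv
    have := ih (F.sem v) v
    simp only [forall_mem_actM_sem_eq, exists_mem_actM_sem_eq, Equiv.swap_inv,
      Equiv.swap_apply_left, Multiset.forall_mem_cons, Multiset.exists_mem_cons, Fm.sem_act,
      true_and] at this
    rw [Multiset.exists_mem_cons]
    refine (this hv).imp_left fun hG => ?_
    rw [Fm.sem, Equiv.swap_apply_eq_iff.1 hG, Equiv.swap_apply_left]
  | cut Γ Δ F i _ _ ih1 ih2 =>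
    intro v hv
    rcases (Multiset.exists_mem_cons).1 (ih2 v hv) with hF | hΔ
    · exact ih1 v (Multiset.forall_mem_cons.2 ⟨hF, hv⟩)
    · exact hΔ
  | weakL Γ Δ F i _ ih => exact fun v hv => ih v (Multiset.forall_mem_cons.1 hv).2
  | weakR Γ Δ F i _ ih => exact fun v hv => Multiset.exists_mem_cons.2 (Or.inr (ih v hv))
  | conL Γ Δ F i _ ih =>
    intro v hv
    exact ih v (Multiset.forall_mem_cons.2 ⟨(Multiset.forall_mem_cons.1 hv).1, hv⟩)
  | conR Γ Δ F i _ ih =>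
    intro v hv
    exact (Multiset.exists_mem_cons.1 (ih v hv)).elim
      (fun hF => Multiset.exists_mem_cons.2 (Or.inl hF)) fun h => h

/-! ### Completeness of PC -/

/-- The number of connectives of a PC formula. -/
def PFm.connectives : PFm → ℕ
  | .tru => 0
  | .fls => 0
  | .var _ => 0
  | .neg P => P.connectives + 1
  | .and P Q => P.connectives + Q.connectives + 1
  | .or P Q => P.connectives + Q.connectives + 1

theorem PProves.weak_add {Γ Δ : Multiset PFm} (h : PProves Γ Δ) (Γ' Δ' : Multiset PFm) :
    PProves (Γ' + Γ) (Δ' + Δ) := by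
  induction Γ' using Multiset.induction with
  | empty =>
    induction Δ' using Multiset.induction with
    | empty => simpa using h
    | cons P Δ' ih => rw [Multiset.cons_add]; exact ih.weakR _ _ _
  | cons P Γ' ih => rw [Multiset.cons_add]; exact ih.weakL _ _ _

theorem PProves.mono {Γ Δ Γ' Δ' : Multiset PFm} (h : PProves Γ Δ) (hΓ : Γ ≤ Γ') (hΔ : Δ ≤ Δ') :
    PProves Γ' Δ' := by
  classical
  rw [← tsub_add_cancel_of_le hΓ, ← tsub_add_cancel_of_le hΔ]
  exact h.weak_add _ _

theorem PProves.of_models_of_atomic {Γ Δ : Multiset PFm} (hΓ : ∀ P ∈ Γ, P.connectives = 0)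
    (hΔ : ∀ P ∈ Δ, P.connectives = 0) (h : PModels Γ Δ) : PProves Γ Δ := by
  classical
  by_contra hn
  obtain ⟨Q, hQ, hv⟩ := h (fun X => if PFm.var X ∈ Γ then 0 else 1) fun P hP => by
    have h0 := hΓ P hP
    cases P with
    | tru => rfl
    | fls => exact absurd (PProves.fls.mono (by simpa using hP) (Multiset.zero_le _)) hn
    | var X => simp [PFm.sem, hP]
    | neg | and | or => simp [PFm.connectives] at h0
  have h0 := hΔ Q hQ
  cases Q with
  | tru => exact hn (PProves.tru.mono (Multiset.zero_le _) (by simpa using hQ))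
  | fls => simp [PFm.sem] at hv
  | var X =>
    have hX : PFm.var X ∈ Γ := by simpa [PFm.sem] using hv
    exact hn ((PProves.id (.var X)).mono (by simpa using hX) (by simpa using hQ))
  | neg | and | or => simp [PFm.connectives] at h0

theorem PFm.sem_neg (v : ℕ → Fin 2) (P : PFm) : (PFm.neg P).sem v = 0 ↔ ¬ P.sem v = 0 := by
  simp [PFm.sem]

theorem PFm.sem_and (v : ℕ → Fin 2) (P Q : PFm) :
    (PFm.and P Q).sem v = 0 ↔ P.sem v = 0 ∧ Q.sem v = 0 := by
  simp [PFm.sem]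

theorem PFm.sem_or (v : ℕ → Fin 2) (P Q : PFm) :
    (PFm.or P Q).sem v = 0 ↔ P.sem v = 0 ∨ Q.sem v = 0 := by
  simp only [PFm.sem]
  split_ifs with h <;> simp [h]

/-- Every valid PC sequent is provable. -/
theorem PModels.proves {Γ Δ : Multiset PFm} (h : PModels Γ Δ) : PProves Γ Δ := by
  induction hm : (Γ.map PFm.connectives).sum + (Δ.map PFm.connectives).sum
    using Nat.strong_induction_on generalizing Γ Δ with
  | _ m ih =>
  subst hm
  by_cases hΓ : ∀ P ∈ Γ, P.connectives = 0
  · by_cases hΔ : ∀ P ∈ Δ, P.connectives = 0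
    · exact PProves.of_models_of_atomic hΓ hΔ h
    push Not at hΔ
    obtain ⟨P, hP, h0⟩ := hΔ
    obtain ⟨Δ, rfl⟩ := Multiset.exists_cons_of_mem hP
    cases P with
    | tru | fls | var => exact absurd rfl h0
    | neg P =>
      refine PProves.negR _ _ _ (ih _ ?_ (fun v => ?_) rfl)
      · simp only [PFm.connectives, Multiset.map_cons, Multiset.sum_cons]; omega
      · have := h v
        simp only [Multiset.forall_mem_cons, Multiset.exists_mem_cons, PFm.sem_neg] at this ⊢
        tauto
    | and P Q =>
      refine PProves.andR _ _ _ _ (ih _ ?_ (fun v => ?_) rfl) (ih _ ?_ (fun v => ?_) rfl)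
      · simp only [PFm.connectives, Multiset.map_cons, Multiset.sum_cons]; omega
      · have := h v
        simp only [Multiset.exists_mem_cons, PFm.sem_and] at this ⊢
        tauto
      · simp only [PFm.connectives, Multiset.map_cons, Multiset.sum_cons]; omega
      · have := h v
        simp only [Multiset.exists_mem_cons, PFm.sem_and] at this ⊢
        tauto
    | or P Q =>
      refine PProves.orR _ _ _ _ (ih _ ?_ (fun v => ?_) rfl)
      · simp only [PFm.connectives, Multiset.map_cons, Multiset.sum_cons]; omega
      · have := h v
        simp only [Multiset.exists_mem_cons, PFm.sem_or] at this ⊢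
        tauto
  · push Not at hΓ
    obtain ⟨P, hP, h0⟩ := hΓ
    obtain ⟨Γ, rfl⟩ := Multiset.exists_cons_of_mem hP
    cases P with
    | tru | fls | var => exact absurd rfl h0
    | neg P =>
      refine PProves.negL _ _ _ (ih _ ?_ (fun v => ?_) rfl)
      · simp only [PFm.connectives, Multiset.map_cons, Multiset.sum_cons]; omega
      · have := h v
        simp only [Multiset.forall_mem_cons, Multiset.exists_mem_cons, PFm.sem_neg] at this ⊢
        tauto
    | and P Q =>
      refine PProves.andL _ _ _ _ (ih _ ?_ (fun v => ?_) rfl)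
      · simp only [PFm.connectives, Multiset.map_cons, Multiset.sum_cons]; omega
      · have := h v
        simp only [Multiset.forall_mem_cons, PFm.sem_and] at this ⊢
        tauto
    | or P Q =>
      refine PProves.orL _ _ _ _ (ih _ ?_ (fun v => ?_) rfl) (ih _ ?_ (fun v => ?_) rfl)
      · simp only [PFm.connectives, Multiset.map_cons, Multiset.sum_cons]; omega
      · have := h v
        simp only [Multiset.forall_mem_cons, PFm.sem_or] at this ⊢
        tauto
      · simp only [PFm.connectives, Multiset.map_cons, Multiset.sum_cons]; omega
      · have := h v
        simp only [Multiset.forall_mem_cons, PFm.sem_or] at this ⊢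
        tauto

/-- If `Γ ⊢_2 Δ` is provable in 2PC, then `(Γ^{(12)})• ⊢ (Δ^{(12)})•` is provable
in PC (dimension `2` of the paper is encoded as `1 : Fin 2`). -/
theorem refutation_to_PC (Γ Δ : Multiset (Fm 2)) (h : Proves Γ 1 Δ) :
    PProves ((actM (Equiv.swap 0 1) Γ).map toPC) ((actM (Equiv.swap 0 1) Δ).map toPC) := by
  refine PModels.proves fun v => ?_
  have hv := h.models v
  have hΓ := forall_mem_actM_sem_eq v (Equiv.swap 0 1) Γ 0
  have hΔ := exists_mem_actM_sem_eq v (Equiv.swap 0 1) Δ 0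
  rw [Equiv.swap_inv, Equiv.swap_apply_left] at hΓ hΔ
  simp only [Multiset.mem_map, forall_exists_index, and_imp, forall_apply_eq_imp_iff₂,
    exists_exists_and_eq_and, sem_toPC, hΓ, hΔ]
  exact hv
end
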